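/- arXiv:2103.13770 — 2 statements merged into one kernel-verified Lean document; each statement's English description precedes it below -/
import Mathlib

section
/- Let 𝓗 be a complex Hilbert space, let δ > 0, and let ρ_δ = {z ∈ ℂ : Re z < −δ}. Let (R(z))_{z ∈ ρ_δ} be a family of bounded linear operators on 𝓗 such that: (i) R(z)* = R(conj z) for all z ∈ ρ_δ; (ii) R(z₁) − R(z₂) = (z₂ − z₁) R(z₁) R(z₂) for all z₁, z₂ ∈ ρ_δ; (iii) for every Ψ ∈ 𝓗, z·R(z)Ψ → Ψ as Re z → −∞ (i.e. for every ε > 0 there is M > 0 such that ‖z R(z) Ψ − Ψ‖ < ε whenever z ∈ ρ_δ and Re z < −M). Then there exists a densely defined self-adjoint operator H on 𝓗 (a linear map defined on a dense subspace D(H) ⊆ 𝓗 equal to its Hilbert adjoint) such that for every z ∈ ρ_δ: R(z) maps 𝓗 into D(H), (z − H) R(z) Ψ = Ψ for all Ψ ∈ 𝓗, and R(z) (z φ − H φ) = φ for all φ ∈ D(H). In particular, for every z ∈ ρ_δ the operator z − H : D(H) → 𝓗 is a bijection with bounded inverse R(z). -/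
/-- The operator `c - A⁻¹`, defined on the range of an injective bounded operator `A`. -/
noncomputable def subInverse {E : Type*} [NormedAddCommGroup E] [InnerProductSpace ℂ E]
    (A : E →L[ℂ] E) (hA : Function.Injective A) (c : ℂ) : E →ₗ.[ℂ] E where
  domain := LinearMap.range A.toLinearMap
  toFun := c • (LinearMap.range A.toLinearMap).subtype -
    (LinearEquiv.ofInjective A.toLinearMap hA).symm.toLinearMap

section subInverse

variable {E : Type*} [NormedAddCommGroup E] [InnerProductSpace ℂ E]
  {A : E →L[ℂ] E} (hA : Function.Injective A) (c : ℂ)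

theorem mem_domain_subInverse {x : E} : x ∈ (subInverse A hA c).domain ↔ ∃ y, A y = x :=
  Iff.rfl

theorem subInverse_apply (x : (subInverse A hA c).domain) {y : E} (hy : A y = x) :
    subInverse A hA c x = c • (x : E) - y := by
  have hx : x = LinearEquiv.ofInjective A.toLinearMap hA y := Subtype.ext hy.symm
  change c • (x : E) - (LinearEquiv.ofInjective A.toLinearMap hA).symm x = _
  exact congrArg (c • (x : E) - ·) ((LinearEquiv.symm_apply_eq _).2 hx)

variable [CompleteSpace E]

theorem dense_domain_subInverse (hsa : ContinuousLinearMap.adjoint A = A) :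
    Dense ((subInverse A hA c).domain : Set E) := by
  change Dense ((LinearMap.range A.toLinearMap : Submodule ℂ E) : Set E)
  rw [Submodule.dense_iff_topologicalClosure_eq_top, Submodule.topologicalClosure_eq_top_iff,
    Submodule.eq_bot_iff]
  intro x hx
  refine hA ?_
  rw [map_zero]
  refine ext_inner_left ℂ fun y => ?_
  rw [inner_zero_right, ← ContinuousLinearMap.adjoint_inner_left, hsa]
  exact (Submodule.mem_orthogonal _ _).1 hx _ ⟨y, rfl⟩

theorem adjoint_subInverse (hsa : ContinuousLinearMap.adjoint A = A)
    (hc : (starRingEnd ℂ) c = c) :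
    (subInverse A hA c).adjoint = subInverse A hA c := by
  have hd := dense_domain_subInverse hA c hsa
  have hsymm : ∀ x y : E, inner ℂ (A x) y = inner ℂ x (A y) := fun x y => by
    rw [← ContinuousLinearMap.adjoint_inner_left, hsa]
  have hle : subInverse A hA c ≤ (subInverse A hA c).adjoint := by
    refine LinearPMap.IsFormalAdjoint.le_adjoint hd ?_
    rintro ⟨_, x, rfl⟩ ⟨_, y, rfl⟩
    rw [subInverse_apply hA c _ (y := x) rfl, subInverse_apply hA c _ (y := y) rfl]
    simp [inner_sub_left, inner_smul_left, hc, hsymm]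
  refine (LinearPMap.eq_of_le_of_domain_eq hle (le_antisymm hle.1 fun y hy => ?_)).symm
  set w := (subInverse A hA c).adjoint ⟨y, hy⟩ with hw
  refine (mem_domain_subInverse hA c).2 ⟨c • y - w, ext_inner_right ℂ fun x => ?_⟩
  have h := LinearPMap.adjoint_isFormalAdjoint hd ⟨y, hy⟩ ⟨A x, x, rfl⟩
  rw [subInverse_apply hA c _ (y := x) rfl, ← hw, inner_sub_right, inner_smul_right] at h
  rw [hsymm, inner_sub_left, inner_smul_left, hc, h]
  simp

end subInverse


/-- **Construction theorem for self-adjoint operators from a pseudo-resolvent family.**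
Let `𝓗` be a complex Hilbert space, `δ > 0` and `ρ_δ = {z : ℂ | Re z < -δ}`.  Given a family
`R z` of bounded operators on `𝓗` indexed by `z ∈ ρ_δ` satisfying `R z * = R (conj z)`,
the resolvent identity `R z₁ - R z₂ = (z₂ - z₁) R z₁ R z₂`, and `z • R z Ψ → Ψ` as
`Re z → -∞`, there exists a densely defined self-adjoint (unbounded) operator `H` such that
for every `z ∈ ρ_δ`, `R z` maps into the domain of `H`, `(z - H) (R z Ψ) = Ψ` for all `Ψ`,
and `R z (z • φ - H φ) = φ` for all `φ` in the domain of `H`. -/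
theorem construction_selfadjoint_from_resolvent_family
    {𝓗 : Type*} [NormedAddCommGroup 𝓗] [InnerProductSpace ℂ 𝓗] [CompleteSpace 𝓗]
    (δ : ℝ) (hδ : 0 < δ) (R : ℂ → 𝓗 →L[ℂ] 𝓗)
    (hadj : ∀ z : ℂ, z.re < -δ → ContinuousLinearMap.adjoint (R z) = R ((starRingEnd ℂ) z))
    (hres : ∀ z₁ z₂ : ℂ, z₁.re < -δ → z₂.re < -δ →
      R z₁ - R z₂ = (z₂ - z₁) • ((R z₁) ∘L (R z₂)))
    (hlim : ∀ Ψ : 𝓗, ∀ ε > (0 : ℝ), ∃ M > (0 : ℝ), ∀ z : ℂ, z.re < -δ → z.re < -M →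
      ‖z • R z Ψ - Ψ‖ < ε) :
    ∃ T : 𝓗 →ₗ.[ℂ] 𝓗, Dense (T.domain : Set 𝓗) ∧ T.adjoint = T ∧
      ∀ z : ℂ, z.re < -δ →
        (∀ Ψ : 𝓗, ∃ hΨ : R z Ψ ∈ T.domain, z • R z Ψ - T ⟨R z Ψ, hΨ⟩ = Ψ) ∧
        (∀ φ : T.domain, R z (z • (φ : 𝓗) - T φ) = (φ : 𝓗)) := by
  have hinj : ∀ z : ℂ, z.re < -δ → Function.Injective (R z) := by
    intro z hz
    refine (injective_iff_map_eq_zero _).2 fun Ψ hΨ => ?_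
    have hker : ∀ w : ℂ, w.re < -δ → R w Ψ = 0 := fun w hw => by
      simpa [hΨ] using DFunLike.congr_fun (hres w z hw hz) Ψ
    refine norm_le_zero_iff.1 (le_of_forall_pos_lt_add fun ε hε => ?_)
    obtain ⟨M, hM, h⟩ := hlim Ψ ε hε
    have hw : ((-δ - M - 1 : ℝ) : ℂ).re < -δ := by
      rw [Complex.ofReal_re]; linarith
    have := h _ hw (by rw [Complex.ofReal_re]; linarith)
    rw [hker _ hw] at this
    simpa using this
  set c : ℂ := ((-δ - 1 : ℝ) : ℂ) with hc
  have hcre : c.re < -δ := by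
    rw [hc, Complex.ofReal_re]; linarith
  have hconj : (starRingEnd ℂ) c = c := Complex.conj_ofReal _
  have hsa : ContinuousLinearMap.adjoint (R c) = R c := by rw [hadj c hcre, hconj]
  refine ⟨subInverse (R c) (hinj c hcre) c, dense_domain_subInverse _ c hsa,
    adjoint_subInverse _ c hsa hconj, fun z hz => ⟨fun Ψ => ?_, ?_⟩⟩
  · have h : R c Ψ - R z Ψ = (z - c) • R c (R z Ψ) := DFunLike.congr_fun (hres c z hcre hz) Ψ
    have hpre : R c (Ψ - (z - c) • R z Ψ) = R z Ψ := by
      rw [map_sub, map_smul, ← h, sub_sub_cancel]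
    refine ⟨⟨_, hpre⟩, ?_⟩
    rw [subInverse_apply _ c _ hpre]
    module
  · rintro ⟨_, Ψ, rfl⟩
    have h : R z Ψ - R c Ψ = (c - z) • R z (R c Ψ) := DFunLike.congr_fun (hres z c hz hcre) Ψ
    rw [subInverse_apply _ c _ (y := Ψ) rfl]
    change R z (z • R c Ψ - (c • R c Ψ - Ψ)) = R c Ψ
    rw [map_sub, map_sub, map_smul, map_smul]
    linear_combination (norm := module) h
end

section
/- For any exponents α, β ≥ 0 there exists a constant C > 0, depending only on d, m_b, m_f, α and β (in particular independent of the integer n in the definition of g), such that for all λ ≥ 0 and all k ∈ ℝ^d: ∫_{ℝ^d} |g(k − q)|² / ( ω_a(q)^α · (ω_a(q)+λ)^β ) dq ≤ C · ‖g‖²_{L²} / ( ω_b(k)^α · (ω_b(k)+λ)^β ), where ‖g‖²_{L²} = ∫ |g(q)|² dq. -/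
open MeasureTheory

/-- The dispersion relation `ω(q) = sqrt(|q|² + m²)` on `ℝ^d`. -/
noncomputable def disp (d : ℕ) (m : ℝ) (q : EuclideanSpace ℝ (Fin d)) : ℝ :=
  Real.sqrt (‖q‖ ^ 2 + m ^ 2)

/-- The rescaled spatial cutoff `g(k) = n^d f(n k)`. -/
noncomputable def cutG (d n : ℕ) (f : EuclideanSpace ℝ (Fin d) → ℝ)
    (x : EuclideanSpace ℝ (Fin d)) : ℝ :=
  (n : ℝ) ^ d * f ((n : ℝ) • x)

theorem disp_pos (d : ℕ) {m : ℝ} (hm : 0 < m) (q : EuclideanSpace ℝ (Fin d)) :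
    0 < disp d m q :=
  Real.sqrt_pos.2 (by positivity)

/-- Dispersion relations at points of distance at most one are comparable, whatever the masses. -/
theorem disp_le_mul_disp (d : ℕ) {m m' : ℝ} (hm : 0 < m) {k q : EuclideanSpace ℝ (Fin d)}
    (hkq : ‖k - q‖ ≤ 1) :
    disp d m' k ≤ (2 + (2 + m' ^ 2) / m ^ 2) * disp d m q := by
  set K := 2 + (2 + m' ^ 2) / m ^ 2 with hK
  have hK2 : 2 ≤ K := le_add_of_nonneg_right (by positivity)
  have hKm : K * m ^ 2 = 2 * m ^ 2 + (2 + m' ^ 2) := by rw [hK]; field_simp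
  have hk : ‖k‖ ≤ 1 + ‖q‖ := by
    have := norm_add_le (k - q) q
    rw [sub_add_cancel] at this
    linarith
  have hk2 : ‖k‖ ^ 2 ≤ 2 + 2 * ‖q‖ ^ 2 := by
    have := pow_le_pow_left₀ (norm_nonneg k) hk 2
    nlinarith [sq_nonneg (‖q‖ - 1)]
  unfold disp
  refine Real.sqrt_le_iff.2 ⟨by positivity, ?_⟩
  rw [mul_pow, Real.sq_sqrt (by positivity)]
  have hq : K * (‖q‖ ^ 2 + m ^ 2) ≤ K ^ 2 * (‖q‖ ^ 2 + m ^ 2) :=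
    mul_le_mul_of_nonneg_right (by nlinarith) (by positivity)
  nlinarith [mul_le_mul_of_nonneg_right hK2 (sq_nonneg ‖q‖), sq_nonneg m]

theorem norm_le_one_of_cutG_ne_zero {d n : ℕ} (hn : 1 ≤ n) {f : EuclideanSpace ℝ (Fin d) → ℝ}
    (hf : Function.support f ⊆ Metric.closedBall 0 1) {x : EuclideanSpace ℝ (Fin d)}
    (hx : cutG d n f x ≠ 0) : ‖x‖ ≤ 1 := by
  have hmem := hf (Function.mem_support.2 (right_ne_zero_of_mul hx))
  rw [mem_closedBall_zero_iff, norm_smul, Real.norm_natCast] at hmem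
  have hn' : (1 : ℝ) ≤ n := by exact_mod_cast hn
  exact (le_mul_of_one_le_left (norm_nonneg x) hn').trans hmem

theorem integrable_cutG_sq {d n : ℕ} (hn : 1 ≤ n) {f : EuclideanSpace ℝ (Fin d) → ℝ}
    (hfm : Measurable f) (hf0 : ∀ x, 0 ≤ f x) (hfb : ∃ Cf : ℝ, ∀ x, f x ≤ Cf)
    (hf : Function.support f ⊆ Metric.closedBall 0 1) :
    Integrable fun x => cutG d n f x ^ 2 := by
  obtain ⟨Cf, hCf⟩ := hfb
  have hmeas : Measurable fun x => cutG d n f x ^ 2 := by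
    unfold cutG
    exact ((hfm.comp (measurable_const_smul (n : ℝ))).const_mul _).pow_const 2
  have hsupp : (Function.support fun x => cutG d n f x ^ 2) ⊆ Metric.closedBall 0 1 := by
    intro x hx
    rw [mem_closedBall_zero_iff]
    exact norm_le_one_of_cutG_ne_zero hn hf fun h => hx (by simp [h])
  rw [← integrableOn_iff_integrable_of_support_subset hsupp]
  refine Measure.integrableOn_of_bounded (M := ((n : ℝ) ^ d * Cf) ^ 2)
    measure_closedBall_lt_top.ne hmeas.aestronglyMeasurable (ae_of_all _ fun x => ?_)
  rw [Real.norm_of_nonneg (sq_nonneg _)]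
  have hx := hf0 ((n : ℝ) • x)
  unfold cutG
  gcongr
  exact hCf _

/-- For exponents `α, β ≥ 0` there is a constant `C > 0` (depending only on `d`, the masses
and the exponents, and independent of `n`, `f`, `λ`, `k`) such that
`∫ |g(k-q)|²/(ω_a(q)^α (ω_a(q)+λ)^β) dq ≤ C ‖g‖² / (ω_b(k)^α (ω_b(k)+λ)^β)`. -/
theorem cutoff_convolution_bound_boson
    (d : ℕ) (hd : 1 ≤ d) (m_b m_f : ℝ) (hmb : 0 < m_b) (hmf : 0 < m_f)
    (α β : ℝ) (hα : 0 ≤ α) (hβ : 0 ≤ β) :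
    ∃ C : ℝ, 0 < C ∧
      ∀ (n : ℕ), 1 ≤ n →
      ∀ f : EuclideanSpace ℝ (Fin d) → ℝ,
        Measurable f → (∀ x, 0 ≤ f x) → (∃ Cf : ℝ, ∀ x, f x ≤ Cf) →
        Function.support f ⊆ Metric.closedBall 0 1 → (∫ x, f x) = 1 →
      ∀ lam : ℝ, 0 ≤ lam →
      ∀ k : EuclideanSpace ℝ (Fin d),
        (∫⁻ q, ENNReal.ofReal
            ((cutG d n f (k - q)) ^ 2 / (disp d m_b q ^ α * (disp d m_b q + lam) ^ β)))
          ≤ ENNReal.ofReal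
              (C * (∫ x, (cutG d n f x) ^ 2) /
                (disp d m_f k ^ α * (disp d m_f k + lam) ^ β)) := by
  set K := 2 + (2 + m_f ^ 2) / m_b ^ 2 with hK
  have hK2 : 2 ≤ K := le_add_of_nonneg_right (by positivity)
  have hK0 : 0 < K := by linarith
  refine ⟨K ^ α * K ^ β, by positivity, ?_⟩
  intro n hn f hfm hf0 hfb hf _ lam hlam k
  have hk := disp_pos d hmf k
  set D := disp d m_f k ^ α * (disp d m_f k + lam) ^ β with hD
  have hD0 : 0 < D := by positivity
  have hint := (integrable_cutG_sq hn hfm hf0 hfb hf).comp_sub_left k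
  have hpoint : ∀ q, (cutG d n f (k - q)) ^ 2 / (disp d m_b q ^ α * (disp d m_b q + lam) ^ β)
      ≤ K ^ α * K ^ β / D * (cutG d n f (k - q)) ^ 2 := by
    intro q
    by_cases h0 : cutG d n f (k - q) = 0
    · simp [h0]
    have hq := disp_pos d hmb q
    have hle : disp d m_f k ≤ K * disp d m_b q :=
      disp_le_mul_disp d hmb (norm_le_one_of_cutG_ne_zero hn hf h0)
    have hle' : disp d m_f k + lam ≤ K * (disp d m_b q + lam) := by nlinarith
    have hDle : D ≤ K ^ α * K ^ β * (disp d m_b q ^ α * (disp d m_b q + lam) ^ β) := by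
      calc D ≤ (K * disp d m_b q) ^ α * (K * (disp d m_b q + lam)) ^ β := by
            rw [hD]; gcongr
        _ = _ := by
            rw [Real.mul_rpow hK0.le hq.le, Real.mul_rpow hK0.le (by positivity)]
            ring
    rw [div_mul_eq_mul_div, div_le_div_iff₀ (by positivity) hD0]
    nlinarith [mul_le_mul_of_nonneg_left hDle (sq_nonneg (cutG d n f (k - q)))]
  calc (∫⁻ q, ENNReal.ofReal
            ((cutG d n f (k - q)) ^ 2 / (disp d m_b q ^ α * (disp d m_b q + lam) ^ β)))
      ≤ ∫⁻ q, ENNReal.ofReal (K ^ α * K ^ β / D * (cutG d n f (k - q)) ^ 2) :=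
        lintegral_mono fun q => ENNReal.ofReal_le_ofReal (hpoint q)
    _ = ENNReal.ofReal (∫ q, K ^ α * K ^ β / D * (cutG d n f (k - q)) ^ 2) :=
        (ofReal_integral_eq_lintegral_ofReal (hint.const_mul _)
          (ae_of_all _ fun q => by positivity)).symm
    _ = _ := by
        rw [integral_const_mul, integral_sub_left_eq_self (fun x => cutG d n f x ^ 2) volume k,
          div_mul_eq_mul_div]
end
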